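/- arXiv:2107.03075 — 2 statements merged into one kernel-verified Lean document; each statement's English description precedes it below -/
import Mathlib

section
/- Let d ≥ 5 be an integer and let a ≥ 0 be a real number. Suppose w : (0,∞) → ℝ is differentiable, satisfies w(t) ≥ 0 for all t > 0, and satisfies w'(t) + ((4-d)/(2t))·w(t) = -(a/2)·t^{d/2} for all t > 0. Then a = 0. -/
/-- Multiplying the equation by the integrating factor `t ^ ((4 - d) / 2)` yields the conserved
quantity `t ^ ((4 - d) / 2) * w t + (a / 6) * t ^ 3`. -/
theorem hasDerivAt_rpow_mul_add_cube_eq_zero (d a : ℝ) {w : ℝ → ℝ} {v t : ℝ} (ht : 0 < t)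
    (hderiv : HasDerivAt w v t)
    (hode : v + ((4 - d) / (2 * t)) * w t = -(a / 2) * t ^ (d / 2)) :
    HasDerivAt (fun x : ℝ => x ^ ((4 - d) / 2) * w x + a / 6 * x ^ 3) 0 t := by
  have h := ((Real.hasDerivAt_rpow_const (p := (4 - d) / 2) (Or.inl ht.ne')).mul hderiv).add
    ((hasDerivAt_pow 3 t).const_mul (a / 6))
  refine h.congr_deriv ?_
  have hpow : t ^ ((4 - d) / 2) * t ^ (d / 2) = t ^ 2 := by
    rw [← Real.rpow_add ht, ← Real.rpow_natCast]
    congr 1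
    push_cast
    ring
  have hv : v = -(a / 2) * t ^ (d / 2) - ((4 - d) / (2 * t)) * w t := by linarith
  rw [hv, Real.rpow_sub_one ht.ne']
  push_cast
  norm_num
  field_simp
  linear_combination (-6 * a * t) * hpow

/-- Rigidity: if `w ≥ 0` on `(0,∞)` solves `w' + ((4-d)/(2t)) w = -(a/2) t^{d/2}`
with `a ≥ 0` and `d ≥ 5`, then `a = 0`. -/
theorem stmt_1 (d : ℕ) (hd : 5 ≤ d) (a : ℝ) (ha : 0 ≤ a) (w w' : ℝ → ℝ)
    (hnonneg : ∀ t : ℝ, 0 < t → 0 ≤ w t)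
    (hderiv : ∀ t : ℝ, 0 < t → HasDerivAt w (w' t) t)
    (hode : ∀ t : ℝ, 0 < t →
      w' t + ((4 - (d : ℝ)) / (2 * t)) * w t = -(a / 2) * t ^ ((d : ℝ) / 2)) :
    a = 0 := by
  have hG (t : ℝ) (ht : 0 < t) :=
    hasDerivAt_rpow_mul_add_cube_eq_zero d a ht (hderiv t ht) (hode t ht)
  have hbound (t : ℝ) (ht : 0 < t) : a / 6 * t ^ 3 ≤ w 1 + a / 6 := by
    have hconst := isOpen_Ioi.is_const_of_deriv_eq_zero isPreconnected_Ioi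
      (fun x hx => (hG x hx).differentiableAt.differentiableWithinAt)
      (fun x hx => (hG x hx).deriv) (Set.mem_Ioi.2 ht) (Set.mem_Ioi.2 one_pos)
    simp only [Real.one_rpow, one_mul, one_pow, mul_one] at hconst
    have := mul_nonneg (Real.rpow_nonneg ht.le ((4 - (d : ℝ)) / 2)) (hnonneg t ht)
    linarith
  by_contra hne
  have hpos : 0 < a := lt_of_le_of_ne ha (Ne.symm hne)
  have hw : 0 ≤ w 1 := hnonneg 1 one_pos
  have ht : 1 ≤ 2 + 6 * w 1 / a := by
    have : 0 ≤ 6 * w 1 / a := by positivity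
    linarith
  have hb := hbound (2 + 6 * w 1 / a) (by linarith)
  have hcube : a / 6 * (2 + 6 * w 1 / a) ≤ a / 6 * (2 + 6 * w 1 / a) ^ 3 := by
    gcongr
    exact le_self_pow₀ ht (by norm_num)
  have hlin : a / 6 * (2 + 6 * w 1 / a) = a / 3 + w 1 := by
    field_simp
    ring
  linarith
end

section
/- Let d ≥ 5 be an integer and let H = {x ∈ ℝ^d : x₁ > 0} be the open upper half-space. Suppose w : H → ℝ is twice continuously differentiable, w(x) > 0 for all x ∈ H, and w satisfies Δw(x) + ((2-d)/x₁)·∂₁w(x) = -(((d-1)² - 9)/(4x₁²))·w(x) on H. Define u : H → ℝ by u(x) = x₁^{-(d-4)/2}·w(x). Assume there exists a real number a ≥ 0 such that -Δu(x) = a·x₁ for all x ∈ H, and assume that for all x ∈ H one has -Δu(x)/u(x) - (2/(d-4))·|∇u(x)|²/u(x)² ≥ 0. Then a = 0 and ∇u(x) = 0 for all x ∈ H. -/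
open scoped BigOperators

/-- The Euclidean Laplacian `Δf(x) = ∑ i, ∂²f/∂xᵢ²` on `ℝ^d`, expressed via
iterated Fréchet derivatives in the standard basis directions. -/
noncomputable def lap {d : ℕ} (f : EuclideanSpace ℝ (Fin d) → ℝ)
    (x : EuclideanSpace ℝ (Fin d)) : ℝ :=
  ∑ i : Fin d,
    fderiv ℝ (fun y => fderiv ℝ f y (EuclideanSpace.single i 1)) x
      (EuclideanSpace.single i 1)

/-- A directional derivative of the product of a function with a power of a coordinate. -/
theorem fderiv_coord_rpow_mul_apply {d : ℕ} (k : Fin d) (r : ℝ)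
    {f : EuclideanSpace ℝ (Fin d) → ℝ} {x : EuclideanSpace ℝ (Fin d)}
    (hx : 0 < x k) (hf : DifferentiableAt ℝ f x) (v : EuclideanSpace ℝ (Fin d)) :
    fderiv ℝ (fun y => y k ^ r * f y) x v
      = r * v k * x k ^ (r - 1) * f x + x k ^ r * fderiv ℝ f x v := by
  have hk : HasFDerivAt (fun y : EuclideanSpace ℝ (Fin d) => y k)
      (EuclideanSpace.proj k : EuclideanSpace ℝ (Fin d) →L[ℝ] ℝ) x :=
    (EuclideanSpace.proj k : EuclideanSpace ℝ (Fin d) →L[ℝ] ℝ).hasFDerivAt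
  have h := (hk.rpow_const (p := r) (Or.inl hx.ne')).mul hf.hasFDerivAt
  rw [show (fun y : EuclideanSpace ℝ (Fin d) => y k ^ r * f y)
    = (fun y => y k ^ r) * f from rfl, h.fderiv]
  simp
  ring

/-- A coordinate power has differentiable product with a differentiable function. -/
theorem differentiableAt_coord_rpow_mul {d : ℕ} (k : Fin d) (r : ℝ)
    {f : EuclideanSpace ℝ (Fin d) → ℝ} {x : EuclideanSpace ℝ (Fin d)}
    (hx : 0 < x k) (hf : DifferentiableAt ℝ f x) :
    DifferentiableAt ℝ (fun y => y k ^ r * f y) x := by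
  have hk : HasFDerivAt (fun y : EuclideanSpace ℝ (Fin d) => y k)
      (EuclideanSpace.proj k : EuclideanSpace ℝ (Fin d) →L[ℝ] ℝ) x :=
    (EuclideanSpace.proj k : EuclideanSpace ℝ (Fin d) →L[ℝ] ℝ).hasFDerivAt
  exact (hk.rpow_const (p := r) (Or.inl hx.ne')).differentiableAt.mul hf

theorem isOpen_coord_pos {d : ℕ} (k : Fin d) :
    IsOpen {x : EuclideanSpace ℝ (Fin d) | 0 < x k} :=
  isOpen_lt continuous_const (by fun_prop)

/-- The Laplacian of the product of a `C²` function with a power of a coordinate. -/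
theorem lap_coord_rpow_mul {d : ℕ} (k : Fin d) (r : ℝ)
    {f : EuclideanSpace ℝ (Fin d) → ℝ}
    (hf : ContDiffOn ℝ 2 f {x | 0 < x k}) {x : EuclideanSpace ℝ (Fin d)} (hx : 0 < x k) :
    lap (fun y => y k ^ r * f y) x
      = r * (r - 1) * x k ^ (r - 2) * f x
        + 2 * r * x k ^ (r - 1) * fderiv ℝ f x (EuclideanSpace.single k 1)
        + x k ^ r * lap f x := by
  have hH := isOpen_coord_pos k
  have hd : ∀ y : EuclideanSpace ℝ (Fin d), 0 < y k → DifferentiableAt ℝ f y := fun y hy =>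
    (hf.contDiffAt (hH.mem_nhds hy)).differentiableAt (by norm_num)
  have hdd : ∀ v, DifferentiableAt ℝ (fun y => fderiv ℝ f y v) x := fun v =>
    (((hf.contDiffAt (hH.mem_nhds hx)).fderiv_right (m := 1) (by norm_num)).differentiableAt
      (by norm_num)).clm_apply (differentiableAt_const v)
  have key : ∀ i : Fin d,
      fderiv ℝ (fun y => fderiv ℝ (fun z => z k ^ r * f z) y (EuclideanSpace.single i 1)) x
        (EuclideanSpace.single i 1)
      = (if i = k then r * (r - 1) * x k ^ (r - 2) * f x
          + 2 * r * x k ^ (r - 1) * fderiv ℝ f x (EuclideanSpace.single k 1) else 0)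
        + x k ^ r * fderiv ℝ (fun y => fderiv ℝ f y (EuclideanSpace.single i 1)) x
            (EuclideanSpace.single i 1) := by
    intro i
    set v : EuclideanSpace ℝ (Fin d) := EuclideanSpace.single i 1 with hv
    have hev : (fun y => fderiv ℝ (fun z => z k ^ r * f z) y v) =ᶠ[nhds x]
        (fun y => (r * v k) * (y k ^ (r - 1) * f y)) + fun y => y k ^ r * fderiv ℝ f y v := by
      filter_upwards [hH.mem_nhds hx] with y hy
      rw [fderiv_coord_rpow_mul_apply k r hy (hd y hy)]
      simp only [Pi.add_apply]
      ring
    have h1 := differentiableAt_coord_rpow_mul k (r - 1) hx (hd x hx)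
    have h2 := differentiableAt_coord_rpow_mul k r hx (hdd v)
    rw [hev.fderiv_eq, fderiv_add (h1.const_mul _) h2, fderiv_const_mul h1,
      add_apply, smul_apply,
      fderiv_coord_rpow_mul_apply k (r - 1) hx (hd x hx),
      fderiv_coord_rpow_mul_apply k r hx (hdd v), smul_eq_mul,
      show r - 1 - 1 = r - 2 by ring]
    by_cases hik : i = k
    · subst hik
      simp [hv]
      ring
    · have : v k = 0 := by simp [hv, Ne.symm hik]
      simp [this, hik]
  simp only [lap]
  rw [Finset.sum_congr rfl fun i _ => key i, Finset.sum_add_distrib, ← Finset.mul_sum]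
  simp

theorem lap_congr_of_eventuallyEq {d : ℕ} {f g : EuclideanSpace ℝ (Fin d) → ℝ}
    {x : EuclideanSpace ℝ (Fin d)} (h : f =ᶠ[nhds x] g) : lap f x = lap g x :=
  Finset.sum_congr rfl fun i _ => by
    have h' : (fun y => fderiv ℝ f y (EuclideanSpace.single i 1)) =ᶠ[nhds x]
        fun y => fderiv ℝ g y (EuclideanSpace.single i 1) :=
      (h.fderiv (𝕜 := ℝ)).mono fun y hy => by simp only [hy]
    rw [h'.fderiv_eq]

/-- A function on `(0, ∞)` with derivative `-a t² / 2`, where `a > 0`, cannot remain positive. -/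
theorem eq_zero_of_hasDerivAt_neg_sq {a : ℝ} (ha : 0 ≤ a) {φ : ℝ → ℝ}
    (hφ : ∀ t, 0 < t → HasDerivAt φ (-(a / 2) * t ^ 2) t) (hpos : ∀ t, 0 < t → 0 < φ t) :
    a = 0 := by
  have hc : ∀ t, 0 < t → HasDerivAt (fun s => φ s + a / 6 * s ^ 3) 0 t := fun t ht => by
    have h := (hφ t ht).add ((hasDerivAt_pow 3 t).const_mul (a / 6))
    refine h.congr_deriv ?_
    norm_num
    ring
  have heq : ∀ t, 0 < t → φ t + a / 6 * t ^ 3 = φ 1 + a / 6 * 1 ^ 3 := fun t ht =>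
    isOpen_Ioi.is_const_of_deriv_eq_zero (convex_Ioi 0).isPreconnected
      (fun s hs => (hc s hs).differentiableAt.differentiableWithinAt)
      (fun s hs => (hc s hs).deriv) ht (Set.mem_Ioi.2 one_pos)
  by_contra hne
  have hap : 0 < a := lt_of_le_of_ne ha (Ne.symm hne)
  set T : ℝ := 1 + 6 * φ 1 / a with hT
  have h1 := hpos 1 one_pos
  have hT1 : 1 ≤ T := by
    have : 0 ≤ 6 * φ 1 / a := by positivity
    linarith
  have haT : a * T = a + 6 * φ 1 := by
    rw [hT]; field_simp
  have hT3 : T ≤ T ^ 3 := le_self_pow₀ hT1 (by norm_num)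
  have := heq T (by linarith)
  have := hpos T (by linarith)
  nlinarith

/-- Rigidity in the boundary blow-up analysis: if `w > 0` is a `C²`
hyperbolic eigenfunction on the upper half-space `H = {x₁ > 0} ⊂ ℝ^d`
(`d ≥ 5`), `u = x₁^{-(d-4)/2} w`, `-Δu = a x₁` on `H` for some `a ≥ 0`, and
`-Δu/u - (2/(d-4)) |∇u|²/u² ≥ 0` on `H`, then `a = 0` and `∇u ≡ 0` on `H`. -/
theorem stmt_4 (d : ℕ) (hd : 5 ≤ d)
    (H : Set (EuclideanSpace ℝ (Fin d)))
    (hH : H = {x : EuclideanSpace ℝ (Fin d) | 0 < x ⟨0, by omega⟩})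
    (w u : EuclideanSpace ℝ (Fin d) → ℝ)
    (hw : ContDiffOn ℝ 2 w H)
    (hwpos : ∀ x ∈ H, 0 < w x)
    (heq : ∀ x ∈ H,
      lap w x + ((2 - (d : ℝ)) / (x ⟨0, by omega⟩)) *
          fderiv ℝ w x (EuclideanSpace.single ⟨0, by omega⟩ 1)
        = -((((d : ℝ) - 1) ^ 2 - 9) / (4 * (x ⟨0, by omega⟩) ^ 2)) * w x)
    (hu : ∀ x ∈ H, u x = (x ⟨0, by omega⟩) ^ (-(((d : ℝ) - 4) / 2)) * w x)
    (a : ℝ) (ha : 0 ≤ a)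
    (hbih : ∀ x ∈ H, -lap u x = a * x ⟨0, by omega⟩)
    (hscal : ∀ x ∈ H,
      0 ≤ -lap u x / u x - (2 / ((d : ℝ) - 4)) * ‖gradient u x‖ ^ 2 / (u x) ^ 2) :
    a = 0 ∧ ∀ x ∈ H, gradient u x = 0 := by
  have hd' : (5 : ℝ) ≤ d := by exact_mod_cast hd
  set k : Fin d := ⟨0, by omega⟩ with hk
  set m : ℝ := ((d : ℝ) - 4) / 2 with hm
  have hopen : IsOpen H := hH ▸ isOpen_coord_pos k
  have hmem : ∀ {x}, x ∈ H ↔ 0 < x k := by simp [hH]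
  have huC : ContDiffOn ℝ 2 u H := by
    refine ContDiffOn.congr (f := fun x => x k ^ (-m) * w x) ?_ hu
    refine ContDiffOn.mul (fun x hx => ?_) hw
    exact (ContDiffAt.rpow_const_of_ne (f := fun y : EuclideanSpace ℝ (Fin d) => y k)
      (by fun_prop) (hmem.1 hx).ne').contDiffWithinAt
  have hud : ∀ x ∈ H, DifferentiableAt ℝ u x := fun x hx =>
    (huC.contDiffAt (hopen.mem_nhds hx)).differentiableAt (by norm_num)
  have hupos : ∀ x ∈ H, 0 < u x := fun x hx => by
    rw [hu x hx]
    exact mul_pos (Real.rpow_pos_of_pos (hmem.1 hx) _) (hwpos x hx)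
  have hwu : ∀ x ∈ H, w x = x k ^ m * u x := fun x hx => by
    have hx0 := hmem.1 hx
    rw [hu x hx, ← mul_assoc, ← Real.rpow_add hx0]
    simp
  have hnormal : ∀ x ∈ H,
      fderiv ℝ u x (EuclideanSpace.single k 1) = -(a / 2) * x k ^ 2 := fun x hx => by
    have hx0 := hmem.1 hx
    have hev : w =ᶠ[nhds x] fun y => y k ^ m * u y :=
      Filter.eventually_of_mem (hopen.mem_nhds hx) hwu
    have h := heq x hx
    have hb := hbih x hx
    rw [lap_congr_of_eventuallyEq hev, hev.fderiv_eq, hwu x hx,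
      lap_coord_rpow_mul k m (hH ▸ huC) hx0, fderiv_coord_rpow_mul_apply k m hx0 (hud x hx),
      Real.rpow_sub hx0, Real.rpow_sub hx0, Real.rpow_one, Real.rpow_two] at h
    have hp := Real.rpow_pos_of_pos hx0 m
    have hdm : (d : ℝ) = 2 * m + 4 := by rw [hm]; ring
    rw [hdm] at h
    simp only [PiLp.single_apply, if_true] at h
    rw [show lap u x = -(a * x k) by linarith] at h
    generalize x k ^ m = p at h hp
    field_simp at h
    refine mul_left_cancel₀ hx0.ne' ?_
    linear_combination (-1 / 8) * h
  have ha0 : a = 0 := by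
    refine eq_zero_of_hasDerivAt_neg_sq ha
      (φ := fun t => u (t • EuclideanSpace.single k (1 : ℝ))) (fun t ht => ?_) fun t ht => ?_
    · have hmt : t • EuclideanSpace.single k (1 : ℝ) ∈ H := hmem.2 (by simpa using ht)
      have hl : HasDerivAt (fun s : ℝ => s • (EuclideanSpace.single k (1 : ℝ)))
          (EuclideanSpace.single k (1 : ℝ)) t := by
        simpa using (hasDerivAt_id t).smul_const (EuclideanSpace.single k (1 : ℝ))
      have h := (hud _ hmt).hasFDerivAt.comp_hasDerivAt t hl
      rw [hnormal _ hmt] at h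
      refine h.congr_deriv ?_
      simp
    · exact hupos _ (hmem.2 (by simpa using ht))
  refine ⟨ha0, fun x hx => ?_⟩
  have hs := hscal x hx
  rw [hbih x hx, ha0, zero_mul, zero_div, zero_sub] at hs
  by_contra hg
  have hg' : 0 < ‖gradient u x‖ := norm_pos_iff.2 hg
  have hux := hupos x hx
  have hd4 : (0 : ℝ) < d - 4 := by linarith
  have : 0 < 2 / ((d : ℝ) - 4) * ‖gradient u x‖ ^ 2 / u x ^ 2 := by positivity
  linarith
end
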